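/- Let f ∈ F_q[x] be any polynomial of degree at least one. Then the set of polynomials g ∈ F_q[x] of degree at least 2 for which there exist real constants c₁, c₂ > 0 with c₁·n ≤ M_{f,g}(n) ≤ c₂·n for all n ≥ 1 is infinite. -/

import Mathlib

open Polynomial UniqueFactorizationMonoid
open scoped Classical

/-- The `n`-th compositional iterate of a polynomial `g`. -/
noncomputable def iterPoly {K : Type*} [CommSemiring K] (g : Polynomial K) : ℕ → Polynomial K
  | 0 => X
  | n + 1 => g.comp (iterPoly g n)

/-- `P_n[f,g] = f(g^{(n)})`. -/
noncomputable def Pn {K : Type*} [CommSemiring K] (f g : Polynomial K) (n : ℕ) : Polynomial K :=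
  f.comp (iterPoly g n)

/-- The finset of (normalized) monic irreducible factors of `P`. -/
noncomputable def irrFactors {K : Type*} [Field K] (P : Polynomial K) : Finset (Polynomial K) :=
  (normalizedFactors P).toFinset

/-- Number of distinct irreducible factors of `P`. -/
noncomputable def Nfac {K : Type*} [Field K] (P : Polynomial K) : ℕ := (irrFactors P).card

/-- Degree of the squarefree part of `P`. -/
noncomputable def Dfac {K : Type*} [Field K] (P : Polynomial K) : ℕ :=
  ∑ r ∈ irrFactors P, r.natDegree

/-- Largest degree of an irreducible factor of `P`. -/
noncomputable def Mfac {K : Type*} [Field K] (P : Polynomial K) : ℕ :=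
  (irrFactors P).sup natDegree

/-- Smallest degree of an irreducible factor of `P`. -/
noncomputable def mfac {K : Type*} [Field K] (P : Polynomial K) : ℕ :=
  sInf {d | ∃ r ∈ irrFactors P, r.natDegree = d}

/-- Largest multiplicity in the irreducible factorization of `P`. -/
noncomputable def Efac {K : Type*} [Field K] (P : Polynomial K) : ℕ :=
  (irrFactors P).sup fun r => (normalizedFactors P).count r

/-- Smallest multiplicity in the irreducible factorization of `P`. -/
noncomputable def efac {K : Type*} [Field K] (P : Polynomial K) : ℕ :=
  sInf {e | ∃ r ∈ irrFactors P, (normalizedFactors P).count r = e}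

/-- Largest multiplicity of a root of `P` in an algebraic closure. -/
noncomputable def nuMax {K : Type*} [Field K] (P : Polynomial K) : ℕ :=
  Efac (P.map (algebraMap K (AlgebraicClosure K)))

/-- Smallest multiplicity of a root of `P` in an algebraic closure. -/
noncomputable def nuMin {K : Type*} [Field K] (P : Polynomial K) : ℕ :=
  efac (P.map (algebraMap K (AlgebraicClosure K)))

/-- The pair `(f, g)` is `p`-critical: `g = a x^{p^h} + b`. -/
def IsPCritical {K : Type*} [Field K] (p : ℕ) (_f g : Polynomial K) : Prop :=
  ∃ (h : ℕ) (a b : K), g = C a * X ^ p ^ h + C b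

/-- The pair `(f, g)` is critical: `f = β (x-α)^{deg f}` and `g = γ (x-α)^{deg g} + α`. -/
def IsCritical {K : Type*} [Field K] (f g : Polynomial K) : Prop :=
  ∃ α β γ : K, f = C β * (X - C α) ^ f.natDegree ∧
    g = C γ * (X - C α) ^ g.natDegree + C α

theorem iterPoly_iterPoly {K : Type*} [CommSemiring K] (g : Polynomial K) (k n : ℕ) :
    iterPoly (iterPoly g k) n = iterPoly g (k * n) := by
  have hcomp : ∀ a b : ℕ, (iterPoly g a).comp (iterPoly g b) = iterPoly g (a + b) := by
    intro a b
    induction a with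
    | zero => simp [iterPoly]
    | succ a ih => rw [Nat.succ_add, iterPoly, iterPoly, comp_assoc, ih]
  induction n with
  | zero => rfl
  | succ n ih => rw [iterPoly, ih, hcomp, Nat.mul_succ, add_comm]

theorem natDegree_iterPoly {K : Type*} [Field K] (g : Polynomial K) (n : ℕ) :
    (iterPoly g n).natDegree = g.natDegree ^ n := by
  induction n with
  | zero => simp [iterPoly]
  | succ n ih => rw [iterPoly, natDegree_comp, ih, pow_succ']

theorem mem_irrFactors {K : Type*} [Field K] {P r : Polynomial K} (hP : P ≠ 0) :
    r ∈ irrFactors P ↔ Irreducible r ∧ r.Monic ∧ r ∣ P := by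
  rw [irrFactors, Multiset.mem_toFinset, Polynomial.mem_normalizedFactors_iff hP]

/-- The polynomial `x^q - x` over the field with `q` elements. -/
noncomputable def frobSub (K : Type*) [Field K] [Fintype K] : Polynomial K :=
  X ^ Fintype.card K - X

section FrobSub

variable {K : Type*} [Field K] [Fintype K]

theorem natDegree_frobSub : (frobSub K).natDegree = Fintype.card K :=
  FiniteField.X_pow_card_sub_X_natDegree_eq K Fintype.one_lt_card

theorem derivative_iterPoly_frobSub (m : ℕ) :
    derivative (iterPoly (frobSub K) m) = (-1) ^ m := by
  induction m with
  | zero => simp [iterPoly]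
  | succ m ih =>
    have h : derivative (frobSub K) = -1 := by
      simp [frobSub, derivative_X_pow]
    rw [iterPoly, derivative_comp, ih, pow_succ, h]
    simp

variable {A : Type*} [Field A] [Algebra K A]

theorem aeval_iterPoly_frobSub (m : ℕ) (x : A) :
    aeval x (iterPoly (frobSub K) m) =
      aeval (FiniteField.frobeniusAlgHom K A).toLinearMap ((X - 1 : K[X]) ^ m) x := by
  induction m with
  | zero => simp [iterPoly]
  | succ m ih =>
    rw [iterPoly, aeval_comp, ih, pow_succ', map_mul, Module.End.mul_apply]
    simp [frobSub]

theorem aeval_frobeniusAlgHom_X_pow_sub_one (n : ℕ) (x : A) :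
    aeval (FiniteField.frobeniusAlgHom K A).toLinearMap (X ^ n - 1 : K[X]) x =
      x ^ Fintype.card K ^ n - x := by
  have h : ∀ n, ((FiniteField.frobeniusAlgHom K A).toLinearMap ^ n) x =
      x ^ Fintype.card K ^ n := by
    intro n
    induction n with
    | zero => simp
    | succ n ih => rw [pow_succ', Module.End.mul_apply, ih, pow_succ, pow_mul]; rfl
  simp [h]

theorem natDegree_minpoly_dvd_iff {x : A} (hx : IsIntegral K x) (n : ℕ) :
    (minpoly K x).natDegree ∣ n ↔ x ^ Fintype.card K ^ n = x := by
  rw [(minpoly.irreducible hx).natDegree_dvd_iff_dvd_X_pow_card_pow_sub_X,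
    minpoly.dvd_iff, Nat.card_eq_fintype_card]
  simp [sub_eq_zero]

omit [Fintype K] in
theorem X_pow_sub_one_mul_X_sub_one_pow_dvd (p : ℕ) [Fact p.Prime] [CharP K p]
    (e : ℕ) {m s : ℕ} (hm : m ≤ p ^ s) :
    (X ^ e - 1) * (X - 1) ^ m ∣ (X ^ (e * p ^ s * p) - 1 : K[X]) := by
  have h₁ : (X - 1 : K[X]) ^ m ∣ X ^ (e * p ^ s) - 1 := by
    refine (pow_dvd_pow _ hm).trans ?_
    rw [sub_pow_char_pow, one_pow, mul_comm, pow_mul]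
    exact sub_one_dvd_pow_sub_one _ _
  have h₂ : (X ^ e - 1 : K[X]) ∣ X ^ (e * p ^ s) - 1 := by
    rw [pow_mul]
    exact sub_one_dvd_pow_sub_one _ _
  refine (mul_dvd_mul h₂ h₁).trans ?_
  rw [← sq, pow_mul _ (e * p ^ s) p, ← one_pow p, ← sub_pow_char, one_pow]
  exact pow_dvd_pow _ (Fact.out : p.Prime).two_le

theorem Pn_frobSub_ne_zero {f : K[X]} (hf : 1 ≤ f.natDegree) (m : ℕ) :
    Pn f (frobSub K) m ≠ 0 := by
  apply ne_zero_of_natDegree_gt (n := 0)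
  rw [Pn, natDegree_comp, natDegree_iterPoly, natDegree_frobSub]
  exact Nat.mul_pos hf (pow_pos Fintype.card_pos _)

theorem Mfac_Pn_frobSub_le (p : ℕ) [Fact p.Prime] [CharP K p] {f : K[X]}
    (hf : 1 ≤ f.natDegree) {m : ℕ} (hm : 1 ≤ m) :
    Mfac (Pn f (frobSub K) m) ≤ f.natDegree.factorial * p * p * m := by
  have hp : p.Prime := Fact.out
  obtain ⟨s, hs₁, hs₂⟩ := exists_nat_pow_near hm hp.one_lt
  refine Finset.sup_le fun r hr => ?_
  obtain ⟨hirr, hmon, hdvd⟩ := (mem_irrFactors (Pn_frobSub_ne_zero hf m)).1 hr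
  obtain ⟨x, hx⟩ := IsAlgClosed.exists_aeval_eq_zero (AlgebraicClosure K) r
    (degree_pos_of_irreducible hirr).ne'
  have hrx : r = minpoly K x := minpoly.eq_of_irreducible_of_monic hirr hx hmon
  have hroot : aeval (aeval x (iterPoly (frobSub K) m)) f = 0 := by
    rw [← aeval_comp]
    exact aeval_eq_zero_of_dvd_aeval_eq_zero hdvd hx
  set α := aeval x (iterPoly (frobSub K) m) with hα
  have hint : ∀ y : AlgebraicClosure K, IsIntegral K y :=
    fun y => Algebra.IsIntegral.isIntegral y
  have hαe : α ^ Fintype.card K ^ f.natDegree.factorial = α := by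
    rw [← natDegree_minpoly_dvd_iff (hint α)]
    refine Nat.dvd_factorial (minpoly.natDegree_pos (hint α)) ?_
    exact natDegree_le_of_dvd (minpoly.dvd _ _ hroot) (ne_zero_of_natDegree_gt hf)
  have hE : x ^ Fintype.card K ^ (f.natDegree.factorial * p ^ (s + 1) * p) = x := by
    rw [← sub_eq_zero, ← aeval_frobeniusAlgHom_X_pow_sub_one]
    obtain ⟨c, hc⟩ :=
      X_pow_sub_one_mul_X_sub_one_pow_dvd (K := K) p f.natDegree.factorial hs₂.le
    rw [hc, mul_comm, map_mul, map_mul, Module.End.mul_apply, Module.End.mul_apply,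
      ← aeval_iterPoly_frobSub, ← hα, aeval_frobeniusAlgHom_X_pow_sub_one, hαe, sub_self,
      map_zero]
  have hdeg := Nat.le_of_dvd (by have := hp.pos; positivity)
    ((natDegree_minpoly_dvd_iff (hint x) _).2 hE)
  rw [hrx]
  refine hdeg.trans ?_
  calc f.natDegree.factorial * p ^ (s + 1) * p = f.natDegree.factorial * p * p * p ^ s := by ring
    _ ≤ _ := Nat.mul_le_mul_left _ hs₁

theorem le_Mfac_Pn_frobSub {f : K[X]} (hf : 1 ≤ f.natDegree) (m : ℕ) :
    m ≤ Mfac (Pn f (frobSub K) m) := by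
  set D := Mfac (Pn f (frobSub K) m) with hD
  set q := Fintype.card K with hq
  have hq₂ : 1 < q := Fintype.one_lt_card
  obtain ⟨α, hα⟩ := IsAlgClosed.exists_aeval_eq_zero (AlgebraicClosure K) f
    (natDegree_pos_iff_degree_pos.1 hf).ne'
  set G := (iterPoly (frobSub K) m).map (algebraMap K (AlgebraicClosure K)) - C α with hG
  have hsep : G.Separable := by
    have hder : derivative G = (-1) ^ m := by
      rw [hG, derivative_sub, derivative_map, derivative_iterPoly_frobSub, derivative_C]
      simp
    rw [Polynomial.Separable, hder]
    exact isCoprime_one_right.of_isCoprime_of_dvd_right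
      (isUnit_one.neg.pow m).dvd
  have hcard : G.roots.toFinset.card = q ^ m := by
    rw [Multiset.toFinset_card_of_nodup (nodup_roots hsep),
      ← (IsAlgClosed.splits G).natDegree_eq_card_roots, hG, natDegree_sub_C, natDegree_map,
      natDegree_iterPoly, natDegree_frobSub]
  have hsub : G.roots.toFinset ⊆ (Finset.Icc 1 D).biUnion fun k =>
      (X ^ q ^ k - X : (AlgebraicClosure K)[X]).roots.toFinset := by
    intro x hx
    have hxG : aeval x (iterPoly (frobSub K) m) = α := by
      have := (mem_roots'.1 (Multiset.mem_toFinset.1 hx)).2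
      simpa [hG, sub_eq_zero, aeval_def, eval_map] using this
    have hint : IsIntegral K x := Algebra.IsIntegral.isIntegral x
    have hmem : minpoly K x ∈ irrFactors (Pn f (frobSub K) m) := by
      rw [mem_irrFactors (Pn_frobSub_ne_zero hf m)]
      refine ⟨minpoly.irreducible hint, minpoly.monic hint, minpoly.dvd _ _ ?_⟩
      rw [Pn, aeval_comp, hxG, hα]
    have hpos := minpoly.natDegree_pos hint
    refine Finset.mem_biUnion.2 ⟨(minpoly K x).natDegree,
      Finset.mem_Icc.2 ⟨hpos, Finset.le_sup (f := natDegree) hmem⟩, ?_⟩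
    rw [Multiset.mem_toFinset,
      mem_roots (FiniteField.X_pow_card_pow_sub_X_ne_zero _ hpos.ne' hq₂)]
    simpa [sub_eq_zero] using (natDegree_minpoly_dvd_iff hint _).1 dvd_rfl
  have hlt : q ^ m < q ^ (D + 1) := by
    calc q ^ m = G.roots.toFinset.card := hcard.symm
      _ ≤ _ := Finset.card_le_card hsub
      _ ≤ ∑ k ∈ Finset.Icc 1 D, q ^ k := by
        refine Finset.card_biUnion_le.trans (Finset.sum_le_sum fun k hk => ?_)
        refine (Multiset.toFinset_card_le _).trans ((card_roots' _).trans_eq ?_)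
        exact FiniteField.X_pow_card_pow_sub_X_natDegree_eq _
          (Nat.one_le_iff_ne_zero.1 (Finset.mem_Icc.1 hk).1) hq₂
      _ < q ^ (D + 1) :=
        Nat.geomSum_lt hq₂ fun k hk => Nat.lt_succ_of_le (Finset.mem_Icc.1 hk).2
  exact Nat.lt_succ_iff.1 ((Nat.pow_lt_pow_iff_right hq₂).1 hlt)

end FrobSub

theorem stmt8 {K : Type*} [Field K] [Fintype K]
    (f : Polynomial K) (hf : 1 ≤ f.natDegree) :
    {g : Polynomial K | 2 ≤ g.natDegree ∧
      ∃ c₁ c₂ : ℝ, 0 < c₁ ∧ 0 < c₂ ∧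
        ∀ n : ℕ, 1 ≤ n →
          c₁ * (n : ℝ) ≤ (Mfac (Pn f g n) : ℝ) ∧
          (Mfac (Pn f g n) : ℝ) ≤ c₂ * (n : ℝ)}.Infinite := by
  obtain ⟨p, hchar⟩ := CharP.exists K
  have : Fact p.Prime := ⟨CharP.char_is_prime K p⟩
  have hp : 0 < p := (Fact.out : p.Prime).pos
  have hq : 1 < Fintype.card K := Fintype.one_lt_card
  refine Set.infinite_of_injective_forall_mem
    (f := fun k : ℕ => iterPoly (frobSub K) (k + 1)) ?_ ?_
  · intro a b hab
    have h := congrArg natDegree hab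
    simp only [natDegree_iterPoly, natDegree_frobSub] at h
    exact Nat.succ_injective (Nat.pow_right_injective hq h)
  · intro k
    refine ⟨?_, 1, ((f.natDegree.factorial * p * p * (k + 1) : ℕ) : ℝ), one_pos, by positivity,
      fun n hn => ?_⟩
    · rw [natDegree_iterPoly, natDegree_frobSub]
      exact le_trans hq (Nat.le_self_pow k.succ_ne_zero _)
    · have hPn : Pn f (iterPoly (frobSub K) (k + 1)) n = Pn f (frobSub K) ((k + 1) * n) := by
        rw [Pn, Pn, iterPoly_iterPoly]
      rw [hPn, one_mul]
      constructor
      · exact_mod_cast (Nat.le_mul_of_pos_left n k.succ_pos).trans (le_Mfac_Pn_frobSub hf _)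
      · have h := Mfac_Pn_frobSub_le p hf (Nat.mul_pos k.succ_pos hn)
        rw [← mul_assoc] at h
        exact_mod_cast h
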